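/- arXiv:1707.08795 — 7 statements merged into one kernel-verified Lean document; each statement's English description precedes it below -/
import Mathlib

section
/- Let d ≥ 1 and let ρ be a density matrix on ℂ^d. Then sInf{ λ ∈ ℝ | ∃ diagonal density matrix σ on ℂ^d such that λ•σ − ρ is positive semidefinite } = sInf{ Tr(σ) | σ is a d×d positive semidefinite matrix such that Δ(σ) − ρ is positive semidefinite }. (Equivalently, 2^{C_max(ρ)} = min{Tr σ : σ ≥ 0, Δ(σ) ≥ ρ}.) -/
open Matrix ComplexOrder

/-- `2^{C_max(ρ)} = min{Tr σ : σ ≥ 0, Δ(σ) ≥ ρ}`. -/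
theorem stmt3 (d : ℕ) (hd : 1 ≤ d) (ρ : Matrix (Fin d) (Fin d) ℂ)
    (hρ : ρ.PosSemidef) (hρtr : ρ.trace = 1) :
    sInf {lam : ℝ | ∃ σ : Matrix (Fin d) (Fin d) ℂ,
        σ.PosSemidef ∧ σ.trace = 1 ∧ σ.IsDiag ∧ (lam • σ - ρ).PosSemidef} =
    sInf {x : ℝ | ∃ σ : Matrix (Fin d) (Fin d) ℂ,
        σ.PosSemidef ∧ (Matrix.diagonal (fun i => σ i i) - ρ).PosSemidef ∧
        x = σ.trace.re} := by
  congr 1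
  ext x
  constructor
  · rintro ⟨σ, hσ, htr, hdiag, hle⟩
    have hx : 0 ≤ x := by
      have h := (Complex.le_def.mp hle.trace_nonneg).1
      simp [trace_sub, trace_smul, htr, hρtr] at h
      linarith
    refine ⟨x • σ, hσ.smul hx, ?_, by simp [trace_smul, htr]⟩
    have hd' : diagonal (fun i => (x • σ) i i) = x • σ :=
      (hdiag.smul x).diagonal_diag
    rwa [hd']
  · rintro ⟨σ, hσ, hle, rfl⟩
    have htr : ((σ.trace.re : ℝ) : ℂ) = σ.trace :=
      (Complex.eq_re_of_ofReal_le (r := 0) (by simpa using hσ.trace_nonneg)).symm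
    have hpos : 0 < σ.trace.re := by
      have h := (Complex.le_def.mp hle.trace_nonneg).1
      rw [trace_sub, trace_diagonal, hρtr] at h
      change 0 ≤ (σ.trace - 1).re at h
      simp at h
      linarith
    have hne : σ.trace ≠ 0 := fun h => by simp [h] at hpos
    refine ⟨σ.trace.re⁻¹ • diagonal (fun i => σ i i), ?_, ?_, ?_, ?_⟩
    · exact (PosSemidef.diagonal fun i => hσ.diag_nonneg).smul (inv_nonneg.mpr hpos.le)
    · rw [trace_smul, trace_diagonal]
      change σ.trace.re⁻¹ • σ.trace = 1
      rw [Complex.real_smul, Complex.ofReal_inv, htr, inv_mul_cancel₀ hne]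
    · exact (isDiag_diagonal _).smul _
    · rwa [smul_inv_smul₀ hpos.ne']
end

section
/- Let d ≥ 1, let Ψ₊ = (1/√d) Σ_{i=1}^d e_i ∈ ℂ^d and P = Ψ₊ Ψ₊†. For every d×d positive semidefinite matrix τ with all diagonal entries equal to 1 (Δ(τ) = I), there exist n ∈ ℕ and d×d diagonal matrices M_1, …, M_n with Σ_j M_j† M_j = I and d · Σ_j M_j† P M_j = τ. (Since the Kraus operators are diagonal, the corresponding channel is strictly incoherent, hence also a DIO and an IO.) -/
open Matrix ComplexOrder

open scoped MatrixOrder Matrix.Norms.L2Operator in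
theorem Matrix.PosSemidef.exists_eq_conjTranspose_mul_self {n : Type*} [Fintype n]
    [DecidableEq n] {A : Matrix n n ℂ} (hA : A.PosSemidef) :
    ∃ B : Matrix n n ℂ, A = Bᴴ * B :=
  CStarAlgebra.nonneg_iff_eq_star_mul_self.mp hA.nonneg

/-- every `τ ≥ 0` with `Δ(τ) = I` arises as `d · E†(Ψ₊Ψ₊†)` for a
channel `E` with diagonal Kraus operators (a strictly incoherent operation). -/
theorem stmt5 (d : ℕ) (hd : 1 ≤ d)
    (Ψp : Fin d → ℂ) (hΨp : Ψp = fun _ => ((Real.sqrt d : ℂ))⁻¹)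
    (P : Matrix (Fin d) (Fin d) ℂ) (hP : P = Matrix.vecMulVec Ψp (star Ψp))
    (τ : Matrix (Fin d) (Fin d) ℂ) (hτ : τ.PosSemidef) (hdiag : ∀ i, τ i i = 1) :
    ∃ (n : ℕ) (M : Fin n → Matrix (Fin d) (Fin d) ℂ),
      (∀ j, (M j).IsDiag) ∧
      (∑ j, (M j)ᴴ * M j) = 1 ∧
      (d : ℂ) • ∑ j, (M j)ᴴ * P * M j = τ := by
  obtain ⟨B, hB⟩ : ∃ B : Matrix (Fin d) (Fin d) ℂ, τ = Bᴴ * B :=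
    hτ.exists_eq_conjTranspose_mul_self
  have hτB (a b : Fin d) : ∑ j, star (B j a) * B j b = τ a b := by
    rw [hB, Matrix.mul_apply]
    simp only [Matrix.conjTranspose_apply]
  have hd0 : (d : ℂ) ≠ 0 := Nat.cast_ne_zero.mpr (by lia)
  have hPd (a b : Fin d) : P a b = (d : ℂ)⁻¹ := by
    have hsq : (Real.sqrt d : ℂ) * (Real.sqrt d : ℂ) = d := by
      exact_mod_cast Real.mul_self_sqrt (Nat.cast_nonneg d)
    simp [hP, hΨp, Matrix.vecMulVec_apply, ← mul_inv, hsq]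
  refine ⟨d, fun j => Matrix.diagonal (B j), fun j => Matrix.isDiag_diagonal _, ?_, ?_⟩
  · ext a b
    rw [Matrix.sum_apply]
    simp only [Matrix.diagonal_conjTranspose, Matrix.diagonal_mul_diagonal]
    by_cases hab : a = b
    · subst hab
      simpa using (hτB a a).trans (hdiag a)
    · simp [hab]
  · ext a b
    rw [Matrix.smul_apply, Matrix.sum_apply, ← hτB a b, smul_eq_mul, Finset.mul_sum]
    refine Finset.sum_congr rfl fun j _ => ?_
    rw [Matrix.diagonal_conjTranspose, Matrix.mul_diagonal, Matrix.diagonal_mul, hPd,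
      Pi.star_apply]
    field_simp
end

section
/- Let d ≥ 1 and let ρ be a density matrix on ℂ^d. Let {E_a}_{a ∈ A} be a finite instrument on d×d matrices: each E_a(X) = Σ_j K_{a,j} X K_{a,j}† for finitely many d×d matrices K_{a,j}, and Σ_{a,j} K_{a,j}† K_{a,j} = I (so Σ_a E_a is trace-preserving). Then sSup{ Σ_a Tr(E_a(ρ) M_a) | {M_a}_{a∈A} a POVM } ≤ (sInf{ λ ∈ ℝ | ∃ diagonal density matrix σ with λ•σ − ρ positive semidefinite }) · sSup{ Σ_a Tr(E_a(σ) M_a) | σ a diagonal density matrix, {M_a}_{a∈A} a POVM }. (That is, p_succ(𝕴, ρ) ≤ 2^{C_max(ρ)} · p^{ICO}_succ(𝕴).) -/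
open Matrix ComplexOrder

section

variable {n : Type*} [Fintype n]

lemma Matrix.PosSemidef.trace_mul_re_nonneg {P Q : Matrix n n ℂ}
    (hP : P.PosSemidef) (hQ : Q.PosSemidef) : 0 ≤ (P * Q).trace.re := by
  classical
  obtain ⟨B, rfl⟩ : ∃ B : Matrix n n ℂ, P = Bᴴ * B := by
    open scoped MatrixOrder in
    exact CStarAlgebra.nonneg_iff_eq_star_mul_self.mp hP.nonneg
  have h := (hQ.mul_mul_conjTranspose_same B).trace_nonneg
  rw [Matrix.mul_assoc, Matrix.trace_mul_comm]
  exact (Complex.le_def.mp h).1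

open scoped Matrix.Norms.L2Operator MatrixOrder in
lemma Matrix.PosSemidef.exists_smul_one_sub_posSemidef [DecidableEq n] {P : Matrix n n ℂ}
    (hP : P.PosSemidef) : ∃ r : ℝ, (r • (1 : Matrix n n ℂ) - P).PosSemidef := by
  refine ⟨‖P‖, ?_⟩
  have h : IsSelfAdjoint P := hP.isHermitian
  rw [← Matrix.le_iff, ← Algebra.algebraMap_eq_smul_one]
  exact h.le_algebraMap_norm_self

/-- The probability that the POVM `M`, measured on the output of the instrument with Kraus operators
`K a j` applied to `X`, returns the branch `a` that occurred. -/
noncomputable def guessingProbability {A : Type*} [Fintype A] {nK : A → ℕ}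
    (K : (a : A) → Fin (nK a) → Matrix n n ℂ) (M : A → Matrix n n ℂ) (X : Matrix n n ℂ) : ℝ :=
  (∑ a, ((∑ j, K a j * X * (K a j)ᴴ) * M a).trace).re

namespace guessingProbability

variable {A : Type*} [Fintype A] {nK : A → ℕ} (K : (a : A) → Fin (nK a) → Matrix n n ℂ)

lemma nonneg {M : A → Matrix n n ℂ} (hM : ∀ a, (M a).PosSemidef) {X : Matrix n n ℂ}
    (hX : X.PosSemidef) : 0 ≤ guessingProbability K M X := by
  rw [guessingProbability, Complex.re_sum]
  refine Finset.sum_nonneg fun a _ => Matrix.PosSemidef.trace_mul_re_nonneg ?_ (hM a)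
  exact Matrix.posSemidef_sum _ fun j _ => hX.mul_mul_conjTranspose_same _

lemma smul_sub (M : A → Matrix n n ℂ) (r : ℝ) (X Y : Matrix n n ℂ) :
    guessingProbability K M (r • X - Y) =
      r * guessingProbability K M X - guessingProbability K M Y := by
  simp [guessingProbability, Matrix.mul_sub, Matrix.sub_mul, Finset.sum_sub_distrib,
    ← Finset.smul_sum, Finset.mul_sum]

lemma one_sub [DecidableEq n] (M : A → Matrix n n ℂ) (X : Matrix n n ℂ) :
    guessingProbability K (fun a => 1 - M a) X =
      guessingProbability K (fun _ => 1) X - guessingProbability K M X := by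
  simp [guessingProbability, Matrix.mul_sub, Finset.sum_sub_distrib]

lemma one [DecidableEq n] (hK : ∑ a, ∑ j, (K a j)ᴴ * K a j = 1) (X : Matrix n n ℂ) :
    guessingProbability K (fun _ => 1) X = X.trace.re := by
  have h : ∑ a, ∑ j, (K a j * X * (K a j)ᴴ).trace = X.trace := by
    calc _ = ((∑ a, ∑ j, (K a j)ᴴ * K a j) * X).trace := by
          simp only [Finset.sum_mul, Matrix.trace_sum]
          refine Finset.sum_congr rfl fun a _ => Finset.sum_congr rfl fun j _ => ?_
          rw [Matrix.trace_mul_comm, Matrix.mul_assoc]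
      _ = X.trace := by rw [hK, Matrix.one_mul]
  simp only [guessingProbability, Matrix.mul_one, Matrix.trace_sum, h]

lemma le_trace [DecidableEq n] (hK : ∑ a, ∑ j, (K a j)ᴴ * K a j = 1) {M : A → Matrix n n ℂ}
    (hM : ∀ a, (M a).PosSemidef) (hM1 : ∑ a, M a = 1) {X : Matrix n n ℂ} (hX : X.PosSemidef) :
    guessingProbability K M X ≤ X.trace.re := by
  classical
  have hcompl (a : A) : (1 - M a).PosSemidef := by
    rw [← hM1, ← Finset.add_sum_erase _ M (Finset.mem_univ a), add_sub_cancel_left]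
    exact Matrix.posSemidef_sum _ fun b _ => hM b
  have h := nonneg K hcompl hX
  rw [one_sub, one K hK] at h
  linarith

end guessingProbability

end

/-- for any instrument `{E_a}`,
`p_succ(𝕴, ρ) ≤ 2^{C_max(ρ)} · p^{ICO}_succ(𝕴)`. -/
theorem stmt8 (d : ℕ) (hd : 1 ≤ d) (ρ : Matrix (Fin d) (Fin d) ℂ)
    (hρ : ρ.PosSemidef) (hρtr : ρ.trace = 1)
    (A : Type) [Fintype A]
    (nK : A → ℕ) (K : (a : A) → Fin (nK a) → Matrix (Fin d) (Fin d) ℂ)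
    (hK : ∑ a, ∑ j, (K a j)ᴴ * K a j = 1) :
    sSup {x : ℝ | ∃ M : A → Matrix (Fin d) (Fin d) ℂ,
        (∀ a, (M a).PosSemidef) ∧ (∑ a, M a) = 1 ∧
        x = (∑ a, ((∑ j, K a j * ρ * (K a j)ᴴ) * M a).trace).re} ≤
    sInf {lam : ℝ | ∃ σ : Matrix (Fin d) (Fin d) ℂ,
        σ.PosSemidef ∧ σ.trace = 1 ∧ σ.IsDiag ∧ (lam • σ - ρ).PosSemidef} *
    sSup {x : ℝ | ∃ (σ : Matrix (Fin d) (Fin d) ℂ) (M : A → Matrix (Fin d) (Fin d) ℂ),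
        σ.PosSemidef ∧ σ.trace = 1 ∧ σ.IsDiag ∧
        (∀ a, (M a).PosSemidef) ∧ (∑ a, M a) = 1 ∧
        x = (∑ a, ((∑ j, K a j * σ * (K a j)ᴴ) * M a).trace).re} := by
  set L := {lam : ℝ | ∃ σ : Matrix (Fin d) (Fin d) ℂ,
    σ.PosSemidef ∧ σ.trace = 1 ∧ σ.IsDiag ∧ (lam • σ - ρ).PosSemidef}
  set T := {x : ℝ | ∃ (σ : Matrix (Fin d) (Fin d) ℂ) (M : A → Matrix (Fin d) (Fin d) ℂ),
    σ.PosSemidef ∧ σ.trace = 1 ∧ σ.IsDiag ∧ (∀ a, (M a).PosSemidef) ∧ (∑ a, M a) = 1 ∧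
    x = guessingProbability K M σ}
  change _ ≤ sInf L * sSup T
  have hT_bdd : BddAbove T := by
    refine ⟨1, ?_⟩
    rintro _ ⟨σ, M, hσ, hσtr, -, hM, hM1, rfl⟩
    simpa [hσtr] using guessingProbability.le_trace K hK hM hM1 hσ
  have hT_nonneg : 0 ≤ sSup T := by
    refine Real.sSup_nonneg ?_
    rintro _ ⟨σ, M, hσ, -, -, hM, -, rfl⟩
    exact guessingProbability.nonneg K hM hσ
  have hL_nonneg : ∀ r ∈ L, 0 ≤ r := by
    rintro r ⟨σ, -, hσtr, -, h⟩
    have := (Complex.le_def.mp h.trace_nonneg).1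
    simp [Matrix.trace_sub, Matrix.trace_smul, hσtr, hρtr] at this
    linarith
  have hL_nonempty : L.Nonempty := by
    have hd0 : (d : ℝ) ≠ 0 := by positivity
    obtain ⟨r, hr⟩ := hρ.exists_smul_one_sub_posSemidef
    refine ⟨r * d, (d : ℝ)⁻¹ • 1, Matrix.PosSemidef.one.smul (by positivity), ?_, ?_, ?_⟩
    · have : (d : ℂ) ≠ 0 := by exact_mod_cast hd0
      simp [Matrix.trace_smul, this]
    · exact Matrix.isDiag_one.smul _
    · rwa [smul_smul, mul_assoc, mul_inv_cancel₀ hd0, mul_one]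
  refine Real.sSup_le ?_ (mul_nonneg (Real.sInf_nonneg hL_nonneg) hT_nonneg)
  rintro _ ⟨M, hM, hM1, rfl⟩
  change guessingProbability K M ρ ≤ _
  have hbound : ∀ r ∈ L, guessingProbability K M ρ ≤ r * sSup T := by
    rintro r ⟨σ, hσ, hσtr, hσd, h⟩
    have hr : 0 ≤ r := hL_nonneg r ⟨σ, hσ, hσtr, hσd, h⟩
    have h1 := guessingProbability.nonneg K hM h
    rw [guessingProbability.smul_sub] at h1
    have h2 : guessingProbability K M σ ≤ sSup T :=
      le_csSup hT_bdd ⟨σ, M, hσ, hσtr, hσd, hM, hM1, rfl⟩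
    linarith [mul_le_mul_of_nonneg_left h2 hr]
  rcases hT_nonneg.eq_or_lt with h0 | hpos
  · obtain ⟨r, hr⟩ := hL_nonempty
    simpa [← h0] using hbound r hr
  · rw [← div_le_iff₀ hpos]
    exact le_csInf hL_nonempty fun r hr => (div_le_iff₀ hpos).mpr (hbound r hr)
end

section
/- Let d ≥ 1, let E be a dephasing-covariant channel on d×d matrices, and for k ∈ {1, …, d} let U_k = Σ_{j=1}^d e^{2πi jk/d} e_j e_j† (diagonal unitaries) and define the subchannels E_k(X) = (1/d) U_k E(X) U_k†. Then: (a) for every POVM {M_k}_{k=1}^d and every diagonal density matrix σ, Σ_{k=1}^d Tr(E_k(σ) M_k) = 1/d; and (b) the family N_k = U_k (Ψ₊Ψ₊†) U_k†, k = 1,…,d, is a POVM, and for every density matrix ρ, Σ_{k=1}^d Tr(E_k(ρ) N_k) = Tr(E(ρ) · Ψ₊Ψ₊†), where Ψ₊ = (1/√d) Σ_{i=1}^d e_i. -/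
open Matrix ComplexOrder

theorem sum_rootOfUnity_pow_mul_star {d : ℕ} {ζ : ℂ} (hζ : IsPrimitiveRoot ζ d) (i j : Fin d) :
    ∑ k : Fin d, ζ ^ (i.val * k.val) * star (ζ ^ (j.val * k.val)) = if i = j then (d : ℂ) else 0 := by
  have hd : d ≠ 0 := (i.pos).ne'
  have hnorm : ‖ζ‖ = 1 := hζ.norm'_eq_one hd
  have hstar : star ζ = ζ⁻¹ := (Complex.inv_eq_conj hnorm).symm
  have hζ0 : ζ ≠ 0 := hζ.ne_zero hd
  have hterm : ∀ k : Fin d, ζ ^ (i.val * k.val) * star (ζ ^ (j.val * k.val))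
      = (ζ ^ i.val / ζ ^ j.val) ^ k.val := by
    intro k
    rw [star_pow, hstar, div_pow, ← pow_mul, ← pow_mul, inv_pow, div_eq_mul_inv]
  rw [Finset.sum_congr rfl fun k _ => hterm k,
    Fin.sum_univ_eq_sum_range (fun k => (ζ ^ i.val / ζ ^ j.val) ^ k) d]
  split_ifs with h
  · subst h
    simp [div_self (pow_ne_zero _ hζ0)]
  · have hne : ζ ^ i.val / ζ ^ j.val ≠ 1 := by
      intro h1
      rw [div_eq_one_iff_eq (pow_ne_zero _ hζ0)] at h1
      exact h (Fin.ext (hζ.pow_inj i.isLt j.isLt h1))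
    rw [geom_sum_eq hne, div_pow, ← pow_mul, ← pow_mul, mul_comm, mul_comm j.val, pow_mul, pow_mul,
      hζ.pow_eq_one]
    simp

theorem trace_sum_mul_mul_conjTranspose {ι m : Type*} [Fintype ι] [Fintype m] [DecidableEq m]
    {K : ι → Matrix m m ℂ} (hK : ∑ i, (K i)ᴴ * K i = 1) (X : Matrix m m ℂ) :
    (∑ i, K i * X * (K i)ᴴ).trace = X.trace := by
  rw [trace_sum]
  have h : ∀ i, (K i * X * (K i)ᴴ).trace = ((K i)ᴴ * K i * X).trace := fun i => by
    rw [trace_mul_comm, Matrix.mul_assoc]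
  rw [Finset.sum_congr rfl fun i _ => h i, ← trace_sum, ← Finset.sum_mul, hK, Matrix.one_mul]

/-- properties of the dephasing-covariant instrument
`E_k(X) = (1/d) U_k E(X) U_k†` built from a DIO channel `E` and the diagonal
unitaries `U_k`. -/
theorem stmt9 (d : ℕ) (hd : 1 ≤ d)
    (n : ℕ) (K : Fin n → Matrix (Fin d) (Fin d) ℂ)
    (hK : ∑ i, (K i)ᴴ * K i = 1)
    (hDIO : ∀ X : Matrix (Fin d) (Fin d) ℂ,
      Matrix.diagonal (fun j => (∑ i, K i * X * (K i)ᴴ) j j)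
        = ∑ i, K i * (Matrix.diagonal fun j => X j j) * (K i)ᴴ)
    (E : Matrix (Fin d) (Fin d) ℂ → Matrix (Fin d) (Fin d) ℂ)
    (hE : E = fun X => ∑ i, K i * X * (K i)ᴴ)
    (U : Fin d → Matrix (Fin d) (Fin d) ℂ)
    (hU : U = fun k => Matrix.diagonal fun j =>
      Complex.exp (2 * (Real.pi : ℂ) * Complex.I * (j.val : ℂ) * (k.val : ℂ) / (d : ℂ)))
    (Ek : Fin d → Matrix (Fin d) (Fin d) ℂ → Matrix (Fin d) (Fin d) ℂ)
    (hEk : Ek = fun k X => ((d : ℂ))⁻¹ • (U k * E X * (U k)ᴴ))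
    (Ψp : Fin d → ℂ) (hΨp : Ψp = fun _ => ((Real.sqrt d : ℂ))⁻¹)
    (P : Matrix (Fin d) (Fin d) ℂ) (hP : P = Matrix.vecMulVec Ψp (star Ψp))
    (N : Fin d → Matrix (Fin d) (Fin d) ℂ) (hN : N = fun k => U k * P * (U k)ᴴ) :
    -- (a) for every POVM and every incoherent state the success probability is 1/d
    ((∀ M : Fin d → Matrix (Fin d) (Fin d) ℂ,
        (∀ k, (M k).PosSemidef) → (∑ k, M k) = 1 →
        ∀ σ : Matrix (Fin d) (Fin d) ℂ, σ.PosSemidef → σ.trace = 1 → σ.IsDiag →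
          ∑ k, (Ek k σ * M k).trace = ((d : ℂ))⁻¹) ∧
    -- (b) the N_k form a POVM achieving overlap Tr(E(ρ)·Ψ₊Ψ₊†)
      ((∀ k, (N k).PosSemidef) ∧ (∑ k, N k) = 1 ∧
        ∀ ρ : Matrix (Fin d) (Fin d) ℂ, ρ.PosSemidef → ρ.trace = 1 →
          ∑ k, (Ek k ρ * N k).trace = (E ρ * P).trace)) := by
  have hd0 : (d : ℂ) ≠ 0 := by exact_mod_cast (by omega : d ≠ 0)
  set ζ : ℂ := Complex.exp (2 * Real.pi * Complex.I / d) with hζdef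
  have hζ : IsPrimitiveRoot ζ d := Complex.isPrimitiveRoot_exp d (by omega)
  have hUζ : ∀ k, U k = diagonal fun j => ζ ^ (j.val * k.val) := by
    intro k
    simp only [hU]
    congr 1
    funext j
    rw [hζdef, ← Complex.exp_nat_mul]
    congr 1
    push_cast
    ring
  have hphase : ∀ a : ℕ, ζ ^ a * star (ζ ^ a) = 1 := by
    intro a
    have hnorm : ‖ζ ^ a‖ = 1 := by rw [norm_pow, hζ.norm'_eq_one (by omega), one_pow]
    have h := Complex.mul_conj' (ζ ^ a)
    rw [hnorm] at h
    simpa using h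
  have hUU : ∀ k, (U k)ᴴ * U k = 1 := by
    intro k
    rw [hUζ, diagonal_conjTranspose, diagonal_mul_diagonal, ← diagonal_one]
    congr 1
    funext j
    rw [Pi.star_apply, mul_comm]
    exact hphase _
  have hUdiag : ∀ k (v : Fin d → ℂ), U k * diagonal v * (U k)ᴴ = diagonal v := by
    intro k v
    rw [hUζ, diagonal_conjTranspose, diagonal_mul_diagonal, diagonal_mul_diagonal]
    congr 1
    funext j
    rw [Pi.star_apply, mul_right_comm, hphase, one_mul]
  refine ⟨?_, ?_, ?_, ?_⟩
  · intro M _ hM σ _ hσtr hσ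
    have hEσ : diagonal (fun j => E σ j j) = E σ := by
      have hdiag : diagonal (fun j => σ j j) = σ := hσ.diagonal_diag
      have h := hDIO σ
      rw [hdiag] at h
      rw [hE]
      exact h
    have hEkσ : ∀ k, Ek k σ = (d : ℂ)⁻¹ • E σ := by
      intro k
      have h := hUdiag k fun j => E σ j j
      rw [hEσ] at h
      simp only [hEk, h]
    have htr : (E σ).trace = 1 := by
      rw [hE, ← hσtr]
      exact trace_sum_mul_mul_conjTranspose hK σ
    simp_rw [hEkσ]
    rw [← trace_sum, ← Finset.mul_sum, hM, Matrix.mul_one, trace_smul, htr, smul_eq_mul, mul_one]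
  · intro k
    rw [hN, hP]
    exact (posSemidef_vecMulVec_self_star Ψp).mul_mul_conjTranspose_same (U k)
  · ext i j
    have hsq : ((Real.sqrt d : ℂ))⁻¹ * star ((Real.sqrt d : ℂ))⁻¹ = (d : ℂ)⁻¹ := by
      rw [star_inv₀, ← mul_inv]
      congr 1
      rw [show star (Real.sqrt d : ℂ) = (Real.sqrt d : ℂ) from Complex.conj_ofReal _,
        ← Complex.ofReal_mul, Real.mul_self_sqrt (Nat.cast_nonneg d), Complex.ofReal_natCast]
    have hNij : ∀ k, N k i j =
        (d : ℂ)⁻¹ * (ζ ^ (i.val * k.val) * star (ζ ^ (j.val * k.val))) := by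
      intro k
      simp only [hN]
      rw [hUζ, diagonal_conjTranspose, mul_diagonal, diagonal_mul, hP, vecMulVec_apply, hΨp,
        Pi.star_apply, Pi.star_apply, hsq]
      ring
    rw [Matrix.sum_apply, Finset.sum_congr rfl fun k _ => hNij k, ← Finset.mul_sum,
      sum_rootOfUnity_pow_mul_star hζ, one_apply]
    split_ifs <;> simp [hd0]
  · intro ρ _ _
    have hterm : ∀ k, (Ek k ρ * N k).trace = (d : ℂ)⁻¹ * (E ρ * P).trace := by
      intro k
      have hprod : U k * E ρ * (U k)ᴴ * (U k * P * (U k)ᴴ) = U k * (E ρ * P) * (U k)ᴴ := by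
        calc _ = U k * E ρ * ((U k)ᴴ * U k) * P * (U k)ᴴ := by simp only [Matrix.mul_assoc]
          _ = _ := by rw [hUU, Matrix.mul_one, Matrix.mul_assoc (U k)]
      simp only [hEk, hN]
      rw [Matrix.smul_mul, trace_smul, smul_eq_mul, hprod, trace_mul_comm, ← Matrix.mul_assoc,
        hUU, Matrix.one_mul]
    simp [hterm, hd0]
end

section
/- Let d ≥ 1 and let ρ be a density matrix on ℂ^d. Then sInf{ λ ∈ ℝ | ∃ diagonal density matrix σ with λ•σ − ρ positive semidefinite } ≥ 1, and this infimum equals 1 if and only if ρ is diagonal. (Faithfulness of the max-relative entropy of coherence: C_max(ρ) ≥ 0 with equality iff ρ is incoherent.) -/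
open Matrix ComplexOrder

namespace Matrix

variable {n : Type*} [Fintype n]

/-- A positive semidefinite matrix is bounded above by its trace times the identity. -/
lemma PosSemidef.trace_smul_one_sub [DecidableEq n] {A : Matrix n n ℂ} (hA : A.PosSemidef) :
    (A.trace • (1 : Matrix n n ℂ) - A).PosSemidef := by
  let U : Matrix n n ℂ := hA.1.eigenvectorUnitary.1
  have hspec : A = U * diagonal (fun i => (hA.1.eigenvalues i : ℂ)) * Uᴴ := by
    conv_lhs => rw [hA.1.spectral_theorem, Unitary.conjStarAlgAut_apply]
    rfl
  have hUU : U * Uᴴ = 1 := Unitary.mul_star_self_of_mem hA.1.eigenvectorUnitary.2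
  have hsub : A.trace • (1 : Matrix n n ℂ) - A =
      U * diagonal (fun i => A.trace - (hA.1.eigenvalues i : ℂ)) * Uᴴ := by
    have hdiag : diagonal (fun i => A.trace - (hA.1.eigenvalues i : ℂ)) =
        A.trace • (1 : Matrix n n ℂ) - diagonal (fun i => (hA.1.eigenvalues i : ℂ)) := by
      rw [smul_one_eq_diagonal, diagonal_sub]
    rw [hdiag, Matrix.mul_sub, Matrix.sub_mul, ← hspec, Matrix.mul_smul, Matrix.mul_one,
      Matrix.smul_mul, hUU]
  rw [hsub]
  refine (PosSemidef.diagonal fun i => ?_).mul_mul_conjTranspose_same U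
  rw [Pi.zero_apply, sub_nonneg, hA.1.trace_eq_sum_eigenvalues]
  exact Finset.single_le_sum (f := fun i => (hA.1.eigenvalues i : ℂ))
    (fun j _ => by exact_mod_cast hA.eigenvalues_nonneg j) (Finset.mem_univ i)

/-- The entries of a positive semidefinite matrix are bounded by its trace. -/
lemma PosSemidef.norm_apply_le_trace_re {A : Matrix n n ℂ} (hA : A.PosSemidef) (i j : n) :
    ‖A i j‖ ≤ A.trace.re := by
  have hnn (k : n) : 0 ≤ (A k k).re := (Complex.nonneg_iff.1 hA.diag_nonneg).1
  have him (k : n) : (A k k).im = 0 := (Complex.nonneg_iff.1 hA.diag_nonneg).2.symm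
  have hle (k : n) : (A k k).re ≤ A.trace.re := by
    rw [trace, Complex.re_sum]
    exact Finset.single_le_sum (f := fun k => (A k k).re) (fun k _ => hnn k) (Finset.mem_univ k)
  have hdet := (Complex.nonneg_iff.1 (hA.submatrix ![i, j]).det_nonneg).1
  have hji : A j i = star (A i j) := (hA.1.apply j i).symm
  have hmul : ‖A i j‖ ^ 2 ≤ (A i i).re * (A j j).re := by
    rw [← Complex.normSq_eq_norm_sq, Complex.normSq_apply]
    rw [det_fin_two] at hdet
    simp [hji, him] at hdet
    linarith
  exact le_of_sq_le_sq (by nlinarith [hnn i, hnn j, hle i, hle j]) ((hnn i).trans (hle i))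

/-- If a unit-trace matrix `ρ` is dominated by `lam • σ` with `σ` diagonal of unit trace, then the
off-diagonal entries of `ρ` are at most `lam - 1` in norm. -/
lemma norm_apply_le_of_posSemidef_smul_sub {ρ σ : Matrix n n ℂ} {lam : ℝ} (hρ : ρ.trace = 1)
    (hσ : σ.trace = 1) (hdiag : σ.IsDiag) (h : (lam • σ - ρ).PosSemidef) {i j : n} (hij : i ≠ j) :
    ‖ρ i j‖ ≤ lam - 1 := by
  simpa [hdiag hij, trace_sub, trace_smul, hρ, hσ] using h.norm_apply_le_trace_re i j

/-- If a unit-trace matrix is dominated by `lam • σ` with `σ` of unit trace, then `1 ≤ lam`. -/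
lemma one_le_of_posSemidef_smul_sub {ρ σ : Matrix n n ℂ} {lam : ℝ} (hρ : ρ.trace = 1)
    (hσ : σ.trace = 1) (h : (lam • σ - ρ).PosSemidef) : 1 ≤ lam := by
  simpa [trace_sub, trace_smul, hρ, hσ] using (Complex.nonneg_iff.1 h.trace_nonneg).1

end Matrix

/-- faithfulness of `C_max`: `2^{C_max(ρ)} ≥ 1`, with equality
iff `ρ` is incoherent (diagonal). -/
theorem stmt10 (d : ℕ) (hd : 1 ≤ d) (ρ : Matrix (Fin d) (Fin d) ℂ)
    (hρ : ρ.PosSemidef) (hρtr : ρ.trace = 1) :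
    1 ≤ sInf {lam : ℝ | ∃ σ : Matrix (Fin d) (Fin d) ℂ,
        σ.PosSemidef ∧ σ.trace = 1 ∧ σ.IsDiag ∧ (lam • σ - ρ).PosSemidef} ∧
    (sInf {lam : ℝ | ∃ σ : Matrix (Fin d) (Fin d) ℂ,
        σ.PosSemidef ∧ σ.trace = 1 ∧ σ.IsDiag ∧ (lam • σ - ρ).PosSemidef} = 1
      ↔ ρ.IsDiag) := by
  set S : Set ℝ := {lam : ℝ | ∃ σ : Matrix (Fin d) (Fin d) ℂ,
    σ.PosSemidef ∧ σ.trace = 1 ∧ σ.IsDiag ∧ (lam • σ - ρ).PosSemidef}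
  have hd0 : (d : ℝ) ≠ 0 := by positivity
  have hne : S.Nonempty := by
    refine ⟨d, (d : ℝ)⁻¹ • 1, PosSemidef.one.smul (by positivity), ?_, isDiag_one.smul _, ?_⟩
    · have : (d : ℂ) ≠ 0 := by exact_mod_cast hd0
      simp [trace_smul, this]
    · rw [smul_inv_smul₀ hd0]
      simpa [hρtr] using hρ.trace_smul_one_sub
  have hlower : ∀ lam ∈ S, 1 ≤ lam := fun _ ⟨_, _, hσ, _, h⟩ =>
    one_le_of_posSemidef_smul_sub hρtr hσ h
  have hone : 1 ≤ sInf S := le_csInf hne hlower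
  refine ⟨hone, fun h i j hij => ?_, fun h => le_antisymm (csInf_le ⟨1, hlower⟩ ?_) hone⟩
  · have hbound : ‖ρ i j‖ + 1 ≤ sInf S := le_csInf hne fun _ ⟨_, _, hσ, hdiag, hpos⟩ =>
      le_sub_iff_add_le.1 (norm_apply_le_of_posSemidef_smul_sub hρtr hσ hdiag hpos hij)
    exact norm_le_zero_iff.1 (by linarith)
  · exact ⟨ρ, hρ, hρtr, h, by simpa using PosSemidef.zero⟩
end

section
/- Let d ≥ 1, let ρ_1, …, ρ_n be density matrices on ℂ^d and p_1, …, p_n ≥ 0 with Σ_i p_i = 1. Writing M(ρ) = sInf{ λ ∈ ℝ | ∃ diagonal density matrix σ with λ•σ − ρ positive semidefinite } (so that M(ρ) = 2^{C_max(ρ)}), one has M(Σ_i p_i ρ_i) ≤ max_i M(ρ_i). (Quasi-convexity of the max-relative entropy of coherence: C_max(Σ_i p_i ρ_i) ≤ max_i C_max(ρ_i).) -/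
open Matrix ComplexOrder

/-- `M(ρ) = 2^{C_max(ρ)}`, the exponentiated max-relative entropy of coherence. -/
noncomputable def Mexp (d : ℕ) (ρ : Matrix (Fin d) (Fin d) ℂ) : ℝ :=
  sInf {lam : ℝ | ∃ σ : Matrix (Fin d) (Fin d) ℂ,
    σ.PosSemidef ∧ σ.trace = 1 ∧ σ.IsDiag ∧ (lam • σ - ρ).PosSemidef}

/-- The set of `lam` such that `ρ ≤ lam • σ` for some incoherent density matrix `σ`. -/
def incoherentBounds (d : ℕ) (ρ : Matrix (Fin d) (Fin d) ℂ) : Set ℝ :=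
  {lam : ℝ | ∃ σ : Matrix (Fin d) (Fin d) ℂ,
    σ.PosSemidef ∧ σ.trace = 1 ∧ σ.IsDiag ∧ (lam • σ - ρ).PosSemidef}

theorem one_le_of_mem_incoherentBounds {d : ℕ} {ρ : Matrix (Fin d) (Fin d) ℂ}
    (htr : ρ.trace = 1) {lam : ℝ} (h : lam ∈ incoherentBounds d ρ) : 1 ≤ lam := by
  obtain ⟨σ, -, hσtr, -, hle⟩ := h
  have h0 := hle.trace_nonneg
  rw [trace_sub, trace_smul, hσtr, htr, Complex.real_smul, mul_one, sub_nonneg] at h0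
  exact_mod_cast h0

open scoped MatrixOrder Matrix.Norms.L2Operator in
theorem incoherentBounds_nonempty {d : ℕ} (hd : 1 ≤ d) {ρ : Matrix (Fin d) (Fin d) ℂ}
    (hρ : ρ.IsHermitian) : (incoherentBounds d ρ).Nonempty := by
  have hd0 : (d : ℝ) ≠ 0 := by positivity
  have hdC : (d : ℂ) ≠ 0 := by exact_mod_cast hd0
  refine ⟨‖ρ‖ * d, (d : ℝ)⁻¹ • 1, PosSemidef.one.smul (by positivity), ?_, ?_, ?_⟩
  · simp [trace_smul, hdC]
  · exact isDiag_one.smul _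
  · have h := IsSelfAdjoint.le_algebraMap_norm_self (a := ρ) hρ
    rw [Matrix.le_iff, Algebra.algebraMap_eq_smul_one] at h
    rwa [smul_smul, mul_assoc, mul_inv_cancel₀ hd0, mul_one]

theorem sum_mem_incoherentBounds {d : ℕ} {ι : Type*} [Fintype ι]
    {ρ : ι → Matrix (Fin d) (Fin d) ℂ} {p lam : ι → ℝ} (hp : ∀ i, 0 ≤ p i)
    (hlam : ∀ i, lam i ∈ incoherentBounds d (ρ i)) (hlam0 : ∀ i, 0 ≤ lam i)
    (hpos : 0 < ∑ i, p i * lam i) :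
    ∑ i, p i * lam i ∈ incoherentBounds d (∑ i, p i • ρ i) := by
  choose σ hσ hσtr hσdiag hle using hlam
  set L := ∑ i, p i * lam i with hL
  refine ⟨L⁻¹ • ∑ i, (p i * lam i) • σ i, ?_, ?_, ?_, ?_⟩
  · exact (posSemidef_sum _ fun i _ => (hσ i).smul (mul_nonneg (hp i) (hlam0 i))).smul
      (inv_nonneg.2 hpos.le)
  · simp only [trace_smul, trace_sum, hσtr, ← Finset.sum_smul]
    rw [← hL, smul_smul, inv_mul_cancel₀ hpos.ne', one_smul]
  · intro i j hij
    simp [Matrix.sum_apply, hσdiag _ hij]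
  · rw [smul_smul, mul_inv_cancel₀ hpos.ne', one_smul, ← Finset.sum_sub_distrib]
    refine posSemidef_sum _ fun i _ => ?_
    rw [mul_smul, ← smul_sub]
    exact (hle i).smul (hp i)

/-- quasi-convexity of `C_max`:
`M(Σ p_i ρ_i) ≤ max_i M(ρ_i)`. -/
theorem stmt11 (d : ℕ) (hd : 1 ≤ d) (n : ℕ) (hn : 0 < n)
    (ρ : Fin n → Matrix (Fin d) (Fin d) ℂ)
    (hρ : ∀ i, (ρ i).PosSemidef) (hρtr : ∀ i, (ρ i).trace = 1)
    (p : Fin n → ℝ) (hp : ∀ i, 0 ≤ p i) (hpsum : ∑ i, p i = 1) :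
    Mexp d (∑ i, p i • ρ i) ≤
      Finset.univ.sup' ⟨⟨0, hn⟩, Finset.mem_univ _⟩ (fun i => Mexp d (ρ i)) := by
  have hbdd : BddBelow (incoherentBounds d (∑ i, p i • ρ i)) := by
    refine ⟨1, fun lam h => one_le_of_mem_incoherentBounds ?_ h⟩
    simp only [trace_sum, trace_smul, hρtr, ← Finset.sum_smul, hpsum, one_smul]
  refine le_of_forall_pos_le_add fun ε hε => ?_
  have hex : ∀ i, ∃ lam ∈ incoherentBounds d (ρ i), lam < Mexp d (ρ i) + ε := fun i =>
    exists_lt_of_csInf_lt (incoherentBounds_nonempty hd (hρ i).isHermitian)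
      (lt_add_of_pos_right _ hε)
  choose lam hlam hlt using hex
  have hone : ∀ i, 1 ≤ lam i := fun i => one_le_of_mem_incoherentBounds (hρtr i) (hlam i)
  have hpos : 0 < ∑ i, p i * lam i :=
    calc 0 < ∑ i, p i := hpsum ▸ one_pos
      _ ≤ ∑ i, p i * lam i :=
        Finset.sum_le_sum fun i _ => le_mul_of_one_le_right (hp i) (hone i)
  set S := Finset.univ.sup' ⟨⟨0, hn⟩, Finset.mem_univ _⟩ fun i => Mexp d (ρ i)
  calc Mexp d (∑ i, p i • ρ i) ≤ ∑ i, p i * lam i :=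
        csInf_le hbdd
          (sum_mem_incoherentBounds hp hlam (fun i => zero_le_one.trans (hone i)) hpos)
    _ ≤ ∑ i, p i * (S + ε) := by
        refine Finset.sum_le_sum fun i _ => mul_le_mul_of_nonneg_left ?_ (hp i)
        have hi : Mexp d (ρ i) ≤ S :=
          Finset.le_sup' (fun i => Mexp d (ρ i)) (Finset.mem_univ i)
        linarith [hlt i]
    _ = S + ε := by rw [← Finset.sum_mul, hpsum, one_mul]
end

section
/- Let d, M ≥ 1, let ρ be a density matrix on ℂ^d, let ε ∈ (0,1), and let E(X) = Σ_j K_j X K_j† be a channel from d×d matrices to M×M matrices (K_j are M×d matrices with Σ_j K_j† K_j = I_d) such that E(σ) is diagonal for every diagonal density matrix σ (a maximally incoherent operation, MIO). Suppose Tr(E(ρ) · Ψ₊^M (Ψ₊^M)†) ≥ 1 − ε, where Ψ₊^M = (1/√M) Σ_{i=1}^M e_i ∈ ℂ^M. Then log₂ M ≤ C^ε_min(ρ) := sSup{ sInf{ −log₂ Tr(Aσ) | σ a diagonal density matrix on ℂ^d } | A a d×d matrix with 0 ≤ A ≤ I in the Loewner order and Tr(Aρ) ≥ 1 − ε }. (The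 smooth min-relative entropy of coherence upper-bounds the one-shot distillable coherence under MIO.) -/
open Matrix ComplexOrder

lemma Matrix.PosSemidef.trace_mul_re_nonneg_s18 {n : Type*} [Fintype n] {A B : Matrix n n ℂ}
    (hA : A.PosSemidef) (hB : B.PosSemidef) : 0 ≤ (A * B).trace.re := by
  obtain ⟨m, v, rfl⟩ := posSemidef_iff_eq_sum_vecMulVec.mp hA
  rw [Finset.sum_mul, trace_sum, Complex.re_sum]
  refine Finset.sum_nonneg fun i _ => ?_
  rw [vecMulVec_mul, trace_vecMulVec, dotProduct_comm, ← dotProduct_mulVec]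
  exact (Complex.le_def.mp (hB.dotProduct_mulVec_nonneg (v i))).1

lemma Matrix.PosSemidef.one_sub_of_trace_eq_one {n : Type*} [Fintype n] [DecidableEq n]
    {A : Matrix n n ℂ} (hA : A.PosSemidef) (htr : A.trace = 1) : (1 - A).PosSemidef := by
  have hsum : ∑ i, hA.1.eigenvalues i = 1 := by
    have h := hA.1.trace_eq_sum_eigenvalues
    rw [htr] at h
    simpa using (congrArg Complex.re h).symm
  have hle (i : n) : hA.1.eigenvalues i ≤ 1 :=
    hsum ▸ Finset.single_le_sum (fun j _ => hA.eigenvalues_nonneg j) (Finset.mem_univ i)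
  have hD : (1 - diagonal (RCLike.ofReal ∘ hA.1.eigenvalues) : Matrix n n ℂ).PosSemidef := by
    rw [← diagonal_one, diagonal_sub, posSemidef_diagonal_iff]
    intro i
    have h : (hA.1.eigenvalues i : ℂ) ≤ 1 := by exact_mod_cast hle i
    simpa using h
  have h := hD.mul_mul_conjTranspose_same (hA.1.eigenvectorUnitary : Matrix n n ℂ)
  have heq := hA.1.spectral_theorem
  rw [Unitary.conjStarAlgAut_apply] at heq
  have hU : (hA.1.eigenvectorUnitary : Matrix n n ℂ) *
      (hA.1.eigenvectorUnitary : Matrix n n ℂ)ᴴ = 1 :=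
    Unitary.coe_mul_star_self hA.1.eigenvectorUnitary
  rw [mul_sub, sub_mul, mul_one, hU] at h
  rw [heq]
  exact h

/-- The Hilbert–Schmidt adjoint of a Kraus map has Kraus operators `(K j)ᴴ`. -/
lemma Matrix.trace_kraus_mul {m n ι : Type*} [Fintype m] [Fintype n] [Fintype ι]
    (K : ι → Matrix m n ℂ) (X : Matrix n n ℂ) (P : Matrix m m ℂ) :
    ((∑ j, K j * X * (K j)ᴴ) * P).trace = ((∑ j, (K j)ᴴ * P * K j) * X).trace := by
  simp only [Finset.sum_mul, trace_sum]
  refine Finset.sum_congr rfl fun j _ => ?_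
  rw [trace_mul_comm, ← Matrix.mul_assoc, ← Matrix.mul_assoc, trace_mul_comm]
  simp only [Matrix.mul_assoc]

/-- A diagonal matrix of trace one has overlap `1 / M` with the maximally coherent state. -/
lemma Matrix.IsDiag.trace_mul_vecMulVec_const {M : ℕ} {T : Matrix (Fin M) (Fin M) ℂ}
    (hT : T.IsDiag) (htr : T.trace = 1) :
    (T * vecMulVec (fun _ : Fin M => ((Real.sqrt M : ℂ))⁻¹)
      (star fun _ : Fin M => ((Real.sqrt M : ℂ))⁻¹)).trace = (M : ℂ)⁻¹ := by
  have hsq : ((Real.sqrt M : ℂ))⁻¹ * ((Real.sqrt M : ℂ))⁻¹ = (M : ℂ)⁻¹ := by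
    rw [← mul_inv, ← Complex.ofReal_mul, Real.mul_self_sqrt (Nat.cast_nonneg M),
      Complex.ofReal_natCast]
  rw [← hT.diagonal_diag]
  simp only [trace, diag_apply, diagonal_mul, vecMulVec_apply, Pi.star_apply, star_inv₀,
    RCLike.star_def, Complex.conj_ofReal, hsq, ← Finset.sum_mul]
  simp only [trace, diag_apply] at htr
  rw [htr, one_mul]

theorem stmt18 (d M : ℕ) (hd : 1 ≤ d) (hM : 1 ≤ M)
    (ρ : Matrix (Fin d) (Fin d) ℂ) (hρ : ρ.PosSemidef) (hρtr : ρ.trace = 1)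
    (ε : ℝ) (hε0 : 0 < ε) (hε1 : ε < 1)
    (n : ℕ) (K : Fin n → Matrix (Fin M) (Fin d) ℂ)
    (hK : ∑ j, (K j)ᴴ * K j = 1)
    (hMIO : ∀ σ : Matrix (Fin d) (Fin d) ℂ,
      σ.PosSemidef → σ.trace = 1 → σ.IsDiag →
        (∑ j, K j * σ * (K j)ᴴ).IsDiag)
    (Ψp : Fin M → ℂ) (hΨp : Ψp = fun _ => ((Real.sqrt M : ℂ))⁻¹)
    (hfid : 1 - ε ≤
      ((∑ j, K j * ρ * (K j)ᴴ) * Matrix.vecMulVec Ψp (star Ψp)).trace.re) :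
    Real.logb 2 M ≤
      sSup {y : ℝ | ∃ A : Matrix (Fin d) (Fin d) ℂ,
        A.PosSemidef ∧ (1 - A).PosSemidef ∧ 1 - ε ≤ (A * ρ).trace.re ∧
        y = sInf {z : ℝ | ∃ σ : Matrix (Fin d) (Fin d) ℂ,
          σ.PosSemidef ∧ σ.trace = 1 ∧ σ.IsDiag ∧
          z = -Real.logb 2 ((A * σ).trace.re)}} := by
  have hdpos : (0 : ℝ) < d := by exact_mod_cast hd
  have hdC : (d : ℂ) ≠ 0 := by exact_mod_cast hdpos.ne'
  have hMC : (M : ℂ) ≠ 0 := by exact_mod_cast (by omega : M ≠ 0)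
  set τ : Matrix (Fin d) (Fin d) ℂ := diagonal fun _ => (d : ℂ)⁻¹ with hτ
  have hτpos : τ.PosSemidef := by
    rw [hτ, posSemidef_diagonal_iff]
    intro i
    rw [← Complex.ofReal_natCast, ← Complex.ofReal_inv]
    exact Complex.zero_le_real.mpr (by positivity)
  have hτtr : τ.trace = 1 := by simp [hτ, hdC]
  have hτdiag : τ.IsDiag := isDiag_diagonal _
  apply le_csSup
  · refine ⟨-Real.logb 2 ((1 - ε) / d), ?_⟩
    rintro y ⟨A, hA, hA1, hAρ, rfl⟩
    have hbdd : BddBelow {z : ℝ | ∃ σ : Matrix (Fin d) (Fin d) ℂ,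
        σ.PosSemidef ∧ σ.trace = 1 ∧ σ.IsDiag ∧ z = -Real.logb 2 ((A * σ).trace.re)} := by
      refine ⟨0, ?_⟩
      rintro z ⟨σ, hσ, hσtr, -, rfl⟩
      have h0 := hA.trace_mul_re_nonneg_s18 hσ
      have h1 := hA1.trace_mul_re_nonneg_s18 hσ
      rw [sub_mul, one_mul, trace_sub, hσtr, Complex.sub_re, Complex.one_re] at h1
      have := Real.logb_nonpos (b := 2) (by norm_num) h0 (by linarith)
      linarith
    refine (csInf_le hbdd ⟨τ, hτpos, hτtr, hτdiag, rfl⟩).trans ?_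
    have hle : 1 - ε ≤ A.trace.re := by
      have h := hA.trace_mul_re_nonneg_s18 (hρ.one_sub_of_trace_eq_one hρtr)
      rw [mul_sub, mul_one, trace_sub, Complex.sub_re] at h
      linarith
    have hval : (A * τ).trace.re = A.trace.re / d := by
      have h : (A * τ).trace = A.trace / (d : ℂ) := by
        simp [hτ, trace, mul_diagonal, ← Finset.sum_mul, div_eq_mul_inv]
      rw [h, ← Complex.ofReal_natCast, Complex.div_ofReal_re]
    rw [hval]
    refine neg_le_neg (Real.logb_le_logb_of_le (by norm_num) ?_ ?_)
    · exact div_pos (by linarith) hdpos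
    · gcongr
  · have hP : (vecMulVec Ψp (star Ψp)).PosSemidef := posSemidef_vecMulVec_self_star Ψp
    have hPtr : (vecMulVec Ψp (star Ψp)).trace = 1 := by
      have h := (isDiag_diagonal fun _ : Fin M => (M : ℂ)⁻¹).trace_mul_vecMulVec_const
        (by simp [hMC])
      rw [← hΨp] at h
      have hs : (diagonal fun _ : Fin M => (M : ℂ)⁻¹) = (M : ℂ)⁻¹ • 1 := by
        rw [smul_one_eq_diagonal]
      rw [hs, smul_mul_assoc, one_mul, trace_smul, smul_eq_mul] at h
      exact mul_left_cancel₀ (inv_ne_zero hMC) (h.trans (mul_one _).symm)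
    refine ⟨∑ j, (K j)ᴴ * vecMulVec Ψp (star Ψp) * K j, ?_, ?_, ?_, ?_⟩
    · exact posSemidef_sum _ fun j _ => hP.conjTranspose_mul_mul_same _
    · rw [← hK, ← Finset.sum_sub_distrib]
      refine posSemidef_sum _ fun j _ => ?_
      have h := (hP.one_sub_of_trace_eq_one hPtr).conjTranspose_mul_mul_same (K j)
      rwa [Matrix.mul_sub, Matrix.sub_mul, Matrix.mul_one] at h
    · rwa [← trace_kraus_mul]
    · have hval (σ : Matrix (Fin d) (Fin d) ℂ) (hσ : σ.PosSemidef) (hσtr : σ.trace = 1)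
          (hσd : σ.IsDiag) : -Real.logb 2
          (((∑ j, (K j)ᴴ * vecMulVec Ψp (star Ψp) * K j) * σ).trace.re) = Real.logb 2 M := by
        have htr : (∑ j, K j * σ * (K j)ᴴ).trace = 1 := by
          have h := trace_kraus_mul K σ 1
          simpa only [Matrix.mul_one, hK, one_mul, hσtr] using h
        rw [← trace_kraus_mul, hΨp, (hMIO σ hσ hσtr hσd).trace_mul_vecMulVec_const htr,
          ← Complex.ofReal_natCast, ← Complex.ofReal_inv, Complex.ofReal_re, Real.logb_inv,
          neg_neg]
      refine Eq.symm (Eq.trans (congrArg sInf ?_) (csInf_singleton (Real.logb 2 M)))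
      ext z
      constructor
      · rintro ⟨σ, hσ, hσtr, hσd, rfl⟩
        exact hval σ hσ hσtr hσd
      · rintro rfl
        exact ⟨τ, hτpos, hτtr, hτdiag, (hval τ hτpos hτtr hτdiag).symm⟩
end
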